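/- Let G be a tree on X and D a minimally rich domain of strict linear orders on X. If every extreme rule on G is strategy-proof on D (with n ≥ 2 agents), then every preference in D is single-peaked on G. -/

import Mathlib

open SimpleGraph

/-- `z` lies on a path from `x` to `y` in `G` (in a tree, the unique path). -/
def pathSet {X : Type*} (G : SimpleGraph X) (x y z : X) : Prop :=
  ∃ p : G.Walk x y, p.IsPath ∧ z ∈ p.support

/-- The path hull `H(S)`: union of paths between pairs of nodes of `S`. -/
def hull {X : Type*} (G : SimpleGraph X) (S : Set X) (z : X) : Prop :=
  ∃ x ∈ S, ∃ y ∈ S, pathSet G x y z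

/-- `m` is a distance minimizer of `x` on the path hull of `S`. -/
def isMinimizer {X : Type*} (G : SimpleGraph X) (x : X) (S : Set X) (m : X) : Prop :=
  hull G S m ∧ ∀ y, hull G S y → G.dist x m ≤ G.dist x y

/-- `ℓ` is a leaf: it has exactly one neighbor. -/
def isLeaf {X : Type*} (G : SimpleGraph X) (ℓ : X) : Prop := ∃! x, G.Adj ℓ x

/-- `t` is the top-ranked alternative of the strict preference `P`. -/
def isTop {X : Type*} (P : X → X → Prop) (t : X) : Prop := ∀ y, y ≠ t → P t y

/-- `P` with peak `t` is single-peaked on the tree `G`. -/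
def singlePeakedAt {X : Type*} (G : SimpleGraph X) (P : X → X → Prop) (t : X) : Prop :=
  ∀ a b, a ≠ b → pathSet G t a b → P b a

theorem path_length_aux {X : Type*} {G : SimpleGraph X} (hG : G.IsTree) {u v : X}
    {p q : G.Walk u v} (hp : p.IsPath) (hq : q.IsPath) : p = q :=
  congrArg Subtype.val (hG.IsAcyclic.path_unique ⟨p, hp⟩ ⟨q, hq⟩)

theorem path_length_dist {X : Type*} {G : SimpleGraph X} (hG : G.IsTree) {u v : X}
    {p : G.Walk u v} (hp : p.IsPath) : p.length = G.dist u v := by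
  obtain ⟨q, hq, hl⟩ := hG.connected.exists_path_of_dist u v
  rw [path_length_aux hG hp hq, hl]

theorem pathSet_dist {X : Type*} {G : SimpleGraph X} (hG : G.IsTree) {u v z : X}
    (h : pathSet G u v z) : G.dist u z + G.dist z v = G.dist u v := by
  classical
  obtain ⟨p, hp, hz⟩ := h
  have h1 := path_length_dist hG hp
  have h2 := congrArg Walk.length (p.take_spec hz)
  rw [Walk.length_append] at h2
  have h3 := dist_le (p.takeUntil z hz)
  have h4 := dist_le (p.dropUntil z hz)
  have h5 := hG.connected.dist_triangle (u := u) (v := z) (w := v)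
  omega

theorem exists_leaf_beyond {X : Type*} [Fintype X] {G : SimpleGraph X} (hG : G.IsTree) {t a : X}
    (hta : t ≠ a) : ∃ ℓ, isLeaf G ℓ ∧ G.dist t a + G.dist a ℓ = G.dist t ℓ := by
  classical
  obtain ⟨ℓ, hℓ, hmax⟩ := Finset.exists_max_image
    (Finset.univ.filter fun v => G.dist t a + G.dist a v = G.dist t v) (fun v => G.dist t v)
    ⟨a, by simp⟩
  simp only [Finset.mem_filter, Finset.mem_univ, true_and] at hℓ hmax
  refine ⟨ℓ, ?_, hℓ⟩
  have htℓ : t ≠ ℓ := by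
    rintro rfl
    have := hG.connected.pos_dist_of_ne hta
    rw [SimpleGraph.dist_self] at hℓ
    omega
  obtain ⟨p, hp, hl⟩ := hG.connected.exists_path_of_dist t ℓ
  have hnil : ¬ p.Nil := Walk.not_nil_of_ne htℓ
  refine ⟨p.penultimate, (p.adj_penultimate hnil).symm, fun w hw => ?_⟩
  by_cases hws : w ∈ p.support
  · have h1 : ℓ ∉ (p.takeUntil w hws).support :=
      Walk.endpoint_notMem_support_takeUntil hp hws hw.ne
    have h2 : ((p.takeUntil w hws).concat hw.symm).IsPath :=
      (hp.takeUntil hws).concat h1 hw.symm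
    rw [path_length_aux hG hp h2, Walk.penultimate_concat]
  · exfalso
    have h1 := path_length_dist hG (hp.concat hws hw)
    rw [Walk.length_concat] at h1
    have h2 := hG.connected.dist_triangle (u := a) (v := ℓ) (w := w)
    have h3 := hG.connected.dist_triangle (u := t) (v := a) (w := w)
    have h4 : G.dist ℓ w = 1 := dist_eq_one_iff_adj.mpr hw
    have := hmax w (by omega)
    omega

theorem minimizer_pair {X : Type*} {G : SimpleGraph X} (hG : G.IsTree) {u v ℓ : X} {S : Set X}
    (hS : ∀ x, x ∈ S ↔ x = u ∨ x = v)
    (h : G.dist u v + G.dist v ℓ = G.dist u ℓ) : isMinimizer G ℓ S v := by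
  have hv : v ∈ S := (hS v).2 (Or.inr rfl)
  refine ⟨⟨v, hv, v, hv, Walk.nil, by simp, by simp⟩, ?_⟩
  rintro y ⟨x, hx, x', hx', hp⟩
  have h1 := pathSet_dist hG hp
  have h2 := hG.connected.dist_triangle (u := u) (v := y) (w := ℓ)
  rw [dist_comm (u := ℓ), dist_comm (u := ℓ)]
  have e1 := G.dist_comm (u := v) (v := y)
  have e2 := G.dist_comm (u := u) (v := y)
  have e3 := G.dist_comm (u := u) (v := v)
  have e4 := hG.connected.dist_triangle (u := v) (v := y) (w := ℓ)
  have e5 : G.dist u u = 0 := SimpleGraph.dist_self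
  have e6 : G.dist v v = 0 := SimpleGraph.dist_self
  rw [hS] at hx hx'
  rcases hx with rfl | rfl <;> rcases hx' with rfl | rfl <;>
    omega

theorem sp_of_extreme_rules_strategyproof {X : Type*} [Fintype X]
    (hX : 3 ≤ Fintype.card X)
    (G : SimpleGraph X) (hG : G.IsTree)
    (n : ℕ) (hn : 2 ≤ n)
    (D : Set (X → X → Prop))
    (hD : ∀ P ∈ D, IsStrictTotalOrder X P)
    (hrich : ∀ a : X, ∃ P ∈ D, isTop P a)
    (hSP : ∀ ℓ : X, isLeaf G ℓ →
      ∀ (P : Fin n → (X → X → Prop)), (∀ i, P i ∈ D) →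
      ∀ (t : Fin n → X), (∀ i, isTop (P i) (t i)) →
      ∀ (i : Fin n) (Q : X → X → Prop), Q ∈ D →
      ∀ t' : X, isTop Q t' →
      ∀ c c' : X,
        isMinimizer G ℓ (Set.range t) c →
        isMinimizer G ℓ (Set.range (Function.update t i t')) c' →
        ¬ P i c' c) :
    ∀ P ∈ D, ∀ t : X, isTop P t → singlePeakedAt G P t := by
  intro P hP t ht a b hab hpath
  have := hD P hP
  by_cases hbt : b = t
  · subst hbt
    exact ht a hab
  have d1 := pathSet_dist hG hpath
  have hta : t ≠ a := by
    rintro rfl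
    have := hG.connected.pos_dist_of_ne hbt
    rw [SimpleGraph.dist_self] at d1
    have := G.dist_comm (u := b) (v := t)
    omega
  obtain ⟨ℓ, hleaf, d2⟩ := exists_leaf_beyond hG hta
  have d3 := hG.connected.dist_triangle (u := t) (v := b) (w := ℓ)
  have d4 := hG.connected.dist_triangle (u := b) (v := a) (w := ℓ)
  obtain ⟨B, hB, hBt⟩ := hrich b
  obtain ⟨A, hA, hAt⟩ := hrich a
  let i0 : Fin n := ⟨0, by omega⟩
  let i1 : Fin n := ⟨1, by omega⟩
  have h10 : i1 ≠ i0 := by simp [i0, i1]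
  have key := hSP ℓ hleaf (Function.update (fun _ => B) i0 P)
    (fun i => by by_cases h : i = i0 <;> simp [Function.update_apply, h, hP, hB])
    (Function.update (fun _ => b) i0 t)
    (fun i => by by_cases h : i = i0 <;> simp [Function.update_apply, h, ht, hBt])
    i0 A hA a hAt b a
    (minimizer_pair hG (u := t) (fun x => ?_) (by omega))
    (minimizer_pair hG (u := b) (fun x => ?_) (by omega))
  · rw [Function.update_self] at key
    rcases trichotomous_of P a b with h | h | h
    · exact absurd h key
    · exact absurd h hab
    · exact h
  · constructor
    · rintro ⟨i, rfl⟩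
      by_cases h : i = i0 <;> simp [Function.update_apply, h]
    · rintro (rfl | rfl)
      · exact ⟨i0, by simp⟩
      · exact ⟨i1, by simp [h10]⟩
  · constructor
    · rintro ⟨i, rfl⟩
      by_cases h : i = i0 <;> simp [Function.update_apply, h]
    · rintro (rfl | rfl)
      · exact ⟨i1, by simp [h10]⟩
      · exact ⟨i0, by simp⟩
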